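/- If G is a simple graph whose chromatic number is at most 4 (i.e., G admits a proper vertex coloring with 4 colors), then there exists a 3-coloring of the edges of G such that for any three pairwise adjacent vertices u, v, w of G, the three edges uv, vw, uw receive three pairwise distinct colors. -/

import Mathlib

/-- A 3-coloring of the edges of a graph is *rainbow on triangles* if for any three
pairwise adjacent vertices, the three edges joining them receive three distinct colors. -/
def RainbowOnTriangles {V : Type*} (G : SimpleGraph V) (c : Sym2 V → Fin 3) : Prop :=
  ∀ u v w : V, G.Adj u v → G.Adj v w → G.Adj u w →
    c s(u, v) ≠ c s(v, w) ∧ c s(v, w) ≠ c s(u, w) ∧ c s(u, v) ≠ c s(u, w)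

/-- The perfect matching of `K₄` containing the edge `ab`, read off from the bitwise
exclusive or of the endpoints; the value on the diagonal is irrelevant. -/
def matchingIndex (a b : Fin 4) : Fin 3 :=
  Fin.ofNat 3 (a.val ^^^ b.val)

theorem matchingIndex_comm (a b : Fin 4) : matchingIndex a b = matchingIndex b a := by
  rw [matchingIndex, matchingIndex, Nat.xor_comm]

theorem matchingIndex_ne_of_ne : ∀ a b c : Fin 4, a ≠ b → b ≠ c → a ≠ c →
    matchingIndex a b ≠ matchingIndex b c ∧ matchingIndex b c ≠ matchingIndex a c ∧
      matchingIndex a b ≠ matchingIndex a c := by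
  decide

/-- Every graph with chromatic number at most `4` (i.e. admitting a proper vertex
`4`-coloring) has an edge 3-coloring that is rainbow on triangles. -/
theorem rainbow_of_colorable_four {V : Type*} (G : SimpleGraph V) (h : G.Colorable 4) :
    ∃ c : Sym2 V → Fin 3, RainbowOnTriangles G c := by
  obtain ⟨f⟩ := h
  refine ⟨Sym2.lift ⟨fun u v => matchingIndex (f u) (f v),
    fun u v => matchingIndex_comm (f u) (f v)⟩, fun u v w huv hvw huw => ?_⟩
  exact matchingIndex_ne_of_ne _ _ _ (f.valid huv) (f.valid hvw) (f.valid huw)
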